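/- arXiv:2605.20283 — 4 statements merged into one kernel-verified Lean document; each statement's English description precedes it below -/
import Mathlib

section
/- Let ξ > 0 and a < b be real numbers. Then the derivative of A^{[1]}_{a,b} at the left endpoint a equals −ρ(b−a), where ρ(t) = (sinh(2 ξ t) − 2 ξ t)/(4 ξ sinh²(ξ t)). -/
/-- `Φ_ξ(t) = (ξ t cosh(ξ t) − sinh(ξ t)) / (2 ξ³)`. -/
noncomputable def Phi (ξ t : ℝ) : ℝ :=
  (ξ * t * Real.cosh (ξ * t) - Real.sinh (ξ * t)) / (2 * ξ ^ 3)

/-- `ψ_ξ(t) = sinh(ξ t) / ξ`. -/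
noncomputable def psi (ξ t : ℝ) : ℝ := Real.sinh (ξ * t) / ξ

/-- `A^{[2]}_{a,b}(t) = sinh(ξ(t−b)) / sinh(ξ(a−b))`. -/
noncomputable def A2 (ξ a b t : ℝ) : ℝ :=
  Real.sinh (ξ * (t - b)) / Real.sinh (ξ * (a - b))

/-- `B^{[2]}_{a,b}(t) = sinh(ξ(t−a)) / sinh(ξ(b−a))`. -/
noncomputable def B2 (ξ a b t : ℝ) : ℝ :=
  Real.sinh (ξ * (t - a)) / Real.sinh (ξ * (b - a))

/-- `A^{[1]}_{a,b}(t) = Φ_ξ(t−b)/ψ_ξ(a−b) − A^{[2]}_{a,b}(t)·Φ_ξ(a−b)/ψ_ξ(a−b)`. -/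
noncomputable def A1 (ξ a b t : ℝ) : ℝ :=
  Phi ξ (t - b) / psi ξ (a - b) - A2 ξ a b t * (Phi ξ (a - b) / psi ξ (a - b))

/-- `B^{[1]}_{a,b}(t) = Φ_ξ(t−a)/ψ_ξ(b−a) − (Φ_ξ(b−a)/ψ_ξ(b−a))·B^{[2]}_{a,b}(t)`. -/
noncomputable def B1 (ξ a b t : ℝ) : ℝ :=
  Phi ξ (t - a) / psi ξ (b - a) - Phi ξ (b - a) / psi ξ (b - a) * B2 ξ a b t

/-- `ρ(t) = (sinh(2ξt) − 2ξt) / (4ξ sinh²(ξt))`. -/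
noncomputable def rho (ξ t : ℝ) : ℝ :=
  (Real.sinh (2 * ξ * t) - 2 * ξ * t) / (4 * ξ * Real.sinh (ξ * t) ^ 2)

/-- `σ(t) = (ξ t cosh(ξ t) − sinh(ξ t)) / (2ξ sinh²(ξt))`. -/
noncomputable def sigma (ξ t : ℝ) : ℝ :=
  (ξ * t * Real.cosh (ξ * t) - Real.sinh (ξ * t)) / (2 * ξ * Real.sinh (ξ * t) ^ 2)

theorem hasDerivAt_Phi {ξ : ℝ} (hξ : ξ ≠ 0) (t : ℝ) :
    HasDerivAt (Phi ξ) (t * Real.sinh (ξ * t) / (2 * ξ)) t := by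
  have hlin : HasDerivAt (fun x : ℝ => ξ * x) ξ t := by
    simpa using (hasDerivAt_id t).const_mul ξ
  refine (((hlin.mul hlin.cosh).sub hlin.sinh).div_const (2 * ξ ^ 3)).congr_deriv ?_
  field_simp
  ring

theorem hasDerivAt_A2 (ξ a b t : ℝ) :
    HasDerivAt (A2 ξ a b) (ξ * Real.cosh (ξ * (t - b)) / Real.sinh (ξ * (a - b))) t := by
  have hlin : HasDerivAt (fun x : ℝ => ξ * (x - b)) ξ t := by
    simpa using ((hasDerivAt_id t).sub_const b).const_mul ξ
  refine (hlin.sinh.div_const (Real.sinh (ξ * (a - b)))).congr_deriv ?_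
  ring

theorem hasDerivAt_A1 {ξ : ℝ} (hξ : ξ ≠ 0) (a b t : ℝ) :
    HasDerivAt (A1 ξ a b)
      ((t - b) * Real.sinh (ξ * (t - b)) / (2 * ξ) / psi ξ (a - b) -
        ξ * Real.cosh (ξ * (t - b)) / Real.sinh (ξ * (a - b)) *
          (Phi ξ (a - b) / psi ξ (a - b))) t :=
  (((hasDerivAt_Phi hξ (t - b)).comp_sub_const t b).div_const _).sub
    ((hasDerivAt_A2 ξ a b t).mul_const _)

/-- The derivative of `A^{[1]}_{a,b}` at the left endpoint `a` equals `−ρ(b−a)`. -/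
theorem deriv_A1_left (ξ a b : ℝ) (hξ : 0 < ξ) (hab : a < b) :
    deriv (A1 ξ a b) a = -rho ξ (b - a) := by
  rw [(hasDerivAt_A1 hξ.ne' a b a).deriv]
  have hs : Real.sinh (ξ * (a - b)) ≠ 0 :=
    Real.sinh_ne_zero.2 (mul_ne_zero hξ.ne' (sub_ne_zero.2 hab.ne))
  have hcosh := Real.cosh_sq (ξ * (a - b))
  have hneg : ξ * (b - a) = -(ξ * (a - b)) := by ring
  have hdouble : 2 * ξ * (b - a) = -(2 * (ξ * (a - b))) := by ring
  rw [rho, hdouble, hneg, Real.sinh_neg, Real.sinh_neg, Real.sinh_two_mul, Phi, psi]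
  generalize Real.sinh (ξ * (a - b)) = s at *
  generalize Real.cosh (ξ * (a - b)) = c at *
  field_simp
  linear_combination -4 * ξ * (a - b) * hcosh
end

section
/- Let ξ > 0 and a < b be real numbers. Then the derivative of B^{[1]}_{a,b} at the left endpoint a equals −σ(b−a), where σ(t) = (ξ t cosh(ξ t) − sinh(ξ t))/(2 ξ sinh²(ξ t)). -/
theorem hasDerivAt_Phi_sub_left (ξ a : ℝ) : HasDerivAt (fun t => Phi ξ (t - a)) 0 a := by
  have hl : HasDerivAt (fun t : ℝ => ξ * (t - a)) ξ a := by
    simpa using ((hasDerivAt_id a).sub_const a).const_mul ξ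
  simpa [Phi] using ((hl.mul hl.cosh).sub hl.sinh).div_const (2 * ξ ^ 3)

theorem hasDerivAt_B2_left (ξ a b : ℝ) :
    HasDerivAt (B2 ξ a b) (ξ / Real.sinh (ξ * (b - a))) a := by
  have hl : HasDerivAt (fun t : ℝ => ξ * (t - a)) ξ a := by
    simpa using ((hasDerivAt_id a).sub_const a).const_mul ξ
  change HasDerivAt (fun t => Real.sinh (ξ * (t - a)) / Real.sinh (ξ * (b - a))) _ a
  simpa using hl.sinh.div_const (Real.sinh (ξ * (b - a)))

/-- The derivative of `B^{[1]}_{a,b}` at the left endpoint `a` equals `−σ(b−a)`. -/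
theorem deriv_B1_left (ξ a b : ℝ) (hξ : 0 < ξ) (hab : a < b) :
    deriv (B1 ξ a b) a = -sigma ξ (b - a) := by
  have hs : Real.sinh (ξ * (b - a)) ≠ 0 :=
    (Real.sinh_pos_iff.mpr (mul_pos hξ (sub_pos.mpr hab))).ne'
  have h : HasDerivAt (B1 ξ a b) _ a :=
    ((hasDerivAt_Phi_sub_left ξ a).div_const (psi ξ (b - a))).sub
      ((hasDerivAt_B2_left ξ a b).const_mul (Phi ξ (b - a) / psi ξ (b - a)))
  rw [h.deriv, sigma, Phi, psi]
  field_simp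
  ring
end

section
/- Let ξ > 0 and a < b be real numbers. Then the derivative of A^{[1]}_{a,b} at the right endpoint b equals σ(b−a), where σ(t) = (ξ t cosh(ξ t) − sinh(ξ t))/(2 ξ sinh²(ξ t)). -/
/-- The derivative of `A^{[1]}_{a,b}` at the right endpoint `b` equals `σ(b−a)`. -/
theorem deriv_A1_right (ξ a b : ℝ) (hξ : 0 < ξ) (hab : a < b) :
    deriv (A1 ξ a b) b = sigma ξ (b - a) := by
  have hS : Real.sinh (ξ * (b - a)) ≠ 0 :=
    (Real.sinh_pos_iff.mpr (mul_pos hξ (sub_pos.mpr hab))).ne'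
  have hneg : ξ * (a - b) = -(ξ * (b - a)) := by ring
  rw [(hasDerivAt_A1 hξ.ne' a b b).deriv]
  simp only [Phi, psi, sigma, hneg, Real.sinh_neg, Real.cosh_neg, sub_self, mul_zero,
    Real.cosh_zero, zero_mul, zero_div]
  field_simp
  ring
end

section
/- Let ξ > 0 and a < b < c be real numbers. Then the interior diagonal entry of the clamped spline system matrix satisfies (B^{[1]}_{a,b})′(b) − (A^{[1]}_{b,c})′(b) = ρ(b−a) + ρ(c−b), where ρ(t) = (sinh(2 ξ t) − 2 ξ t)/(4 ξ sinh²(ξ t)). -/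
theorem hasDerivAt_B2 (ξ a b t : ℝ) :
    HasDerivAt (B2 ξ a b) (ξ * Real.cosh (ξ * (t - a)) / Real.sinh (ξ * (b - a))) t := by
  have h : HasDerivAt (fun s : ℝ => ξ * (s - a)) ξ t := by
    simpa using ((hasDerivAt_id t).sub_const a).const_mul ξ
  exact (h.sinh.div_const _).congr_deriv (by ring)

theorem hasDerivAt_B1_right {ξ a b : ℝ} (hξ : ξ ≠ 0) (hab : a ≠ b) :
    HasDerivAt (B1 ξ a b) (rho ξ (b - a)) b := by
  have hS : Real.sinh (ξ * (b - a)) ≠ 0 :=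
    Real.sinh_ne_zero.mpr (mul_ne_zero hξ (sub_ne_zero.mpr hab.symm))
  have hPhi := ((hasDerivAt_Phi hξ (b - a)).comp_sub_const b a).div_const (psi ξ (b - a))
  have hB2 := (hasDerivAt_B2 ξ a b b).const_mul (Phi ξ (b - a) / psi ξ (b - a))
  refine (hPhi.sub hB2).congr_deriv ?_
  have hC := Real.cosh_sq (ξ * (b - a))
  rw [rho, psi, Phi, mul_assoc 2 ξ (b - a), Real.sinh_two_mul]
  generalize Real.sinh (ξ * (b - a)) = S at hS hC ⊢
  generalize Real.cosh (ξ * (b - a)) = C at hC ⊢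
  generalize b - a = h
  field_simp
  linear_combination (-4 * h * ξ) * hC

theorem A1_eq_B1_swap (ξ a b : ℝ) : A1 ξ a b = B1 ξ b a := by
  funext t
  simp only [A1, B1, A2, B2, mul_comm]

theorem rho_neg (ξ t : ℝ) : rho ξ (-t) = -rho ξ t := by
  simp only [rho, mul_neg, Real.sinh_neg, neg_sq]
  ring

/-- For `a < b < c`, the interior diagonal entry of the clamped spline system
matrix satisfies `(B^{[1]}_{a,b})′(b) − (A^{[1]}_{b,c})′(b) = ρ(b−a) + ρ(c−b)`. -/
theorem interior_diagonal_entry (ξ a b c : ℝ) (hξ : 0 < ξ) (hab : a < b) (hbc : b < c) :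
    deriv (B1 ξ a b) b - deriv (A1 ξ b c) b = rho ξ (b - a) + rho ξ (c - b) := by
  rw [A1_eq_B1_swap, (hasDerivAt_B1_right hξ.ne' hab.ne).deriv,
    (hasDerivAt_B1_right hξ.ne' hbc.ne').deriv, ← neg_sub c b, rho_neg, sub_neg_eq_add]
end
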